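/- arXiv:1306.1684 — 3 statements merged into one kernel-verified Lean document; each statement's English description precedes it below -/
import Mathlib

section
/- The following conditions on an element Λ of a finite-dimensional reductive Lie algebra g over an algebraically closed field of characteristic 0 are equivalent: (i) ad Λ is a semisimple endomorphism of g; (iii) ker(ad Λ) ∩ im(ad Λ) = 0; (iv) g = ker(ad Λ) + im(ad Λ); (v) g = ker(ad Λ) ⊕ im(ad Λ). -/
namespace Module.End

variable {K V : Type*} [Field K] [AddCommGroup V] [Module K V]

lemma IsSemisimple.disjoint_ker_range {f : End K V} (hf : f.IsSemisimple) :
    Disjoint (LinearMap.ker f) (LinearMap.range f) := by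
  obtain ⟨q, hq, hc⟩ := isSemisimple_iff.mp hf (LinearMap.ker f) fun x hx ↦ by
    simp_all
  refine hc.disjoint.mono_right ?_
  rintro - ⟨x, rfl⟩
  obtain ⟨y, hy, z, hz, rfl⟩ := Submodule.mem_sup.mp (hc.sup_eq_top ▸ Submodule.mem_top (x := x))
  rw [map_add, LinearMap.mem_ker.mp hy, zero_add]
  exact hq hz

lemma isCompl_ker_range_iff_disjoint [FiniteDimensional K V] {f : End K V} :
    IsCompl (LinearMap.ker f) (LinearMap.range f) ↔
      Disjoint (LinearMap.ker f) (LinearMap.range f) := by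
  refine ⟨IsCompl.disjoint, fun h ↦ ⟨h, codisjoint_iff.mpr ?_⟩⟩
  apply Submodule.eq_top_of_disjoint _ _ ?_ h
  rw [add_comm, f.finrank_range_add_finrank_ker]

lemma isCompl_ker_range_iff_codisjoint [FiniteDimensional K V] {f : End K V} :
    IsCompl (LinearMap.ker f) (LinearMap.range f) ↔
      Codisjoint (LinearMap.ker f) (LinearMap.range f) := by
  refine ⟨IsCompl.codisjoint, fun h ↦ ⟨disjoint_iff.mpr ?_, h⟩⟩
  have := Submodule.finrank_sup_add_finrank_inf_eq (LinearMap.ker f) (LinearMap.range f)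
  rw [codisjoint_iff.mp h, finrank_top, add_comm (finrank K (LinearMap.ker f)),
    f.finrank_range_add_finrank_ker] at this
  exact Submodule.finrank_eq_zero.mp (by omega)

open Polynomial in
/-- If the kernel and range of `f` are disjoint, then `f` is semisimple as soon as it is semiconjugate
to a semisimple endomorphism via a map whose kernel is contained in that of `f`. -/
lemma isSemisimple_of_disjoint_of_semiconj [PerfectField K] {W : Type*} [AddCommGroup W]
    [Module K W] [FiniteDimensional K W] {f : End K V} {g : End K W} (π : V →ₗ[K] W)
    (hπ : π ∘ₗ f = g ∘ₗ π) (hker : LinearMap.ker π ≤ LinearMap.ker f) (hg : g.IsSemisimple)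
    (h : Disjoint (LinearMap.ker f) (LinearMap.range f)) : f.IsSemisimple := by
  set p := minpoly K g
  have hp : Squarefree p := hg.minpoly_squarefree
  have haeval (x : V) (q : K[X]) : π (aeval f q x) = aeval g q (π x) := by
    induction q using Polynomial.induction_on' with
    | add q r hq hr => simp [hq, hr]
    | monomial n a =>
      have hpow : π ((f ^ n) x) = (g ^ n) (π x) := by
        induction n generalizing x with
        | zero => simp
        | succ n ih => simpa [pow_succ, ih] using congr_arg (g ^ n) (LinearMap.congr_fun hπ x)
      simp [aeval_monomial, hpow]
  have hfp (x : V) : f (aeval f p x) = 0 := hker <| by simp [haeval, p]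
  by_cases hX : X ∣ p
  · obtain ⟨q, hq⟩ := hX
    refine isSemisimple_of_squarefree_aeval_eq_zero hp (LinearMap.ext fun x ↦ ?_)
    refine Submodule.disjoint_def.mp h _ (hfp x) ?_
    rw [hq]
    exact ⟨aeval f q x, by simp⟩
  · refine isSemisimple_of_squarefree_aeval_eq_zero (p := X * p) ?_ (LinearMap.ext fun x ↦ ?_)
    · exact (squarefree_mul_iff).mpr
        ⟨(irreducible_X.coprime_iff_not_dvd.mpr hX).isRelPrime, irreducible_X.squarefree, hp⟩
    · simpa using hfp x

end Module.End

namespace LieAlgebra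

open Module

section

variable {K L : Type*} [Field K] [LieRing L] [LieAlgebra K L]

/-- The semisimple part of an inner derivation is a derivation. -/
lemma leibniz_of_isNilpotent_of_isSemisimple [IsAlgClosed K] [FiniteDimensional K L] {x : L}
    {n s : End K L} (hc : Commute n s) (hn : IsNilpotent n) (hs : s.IsSemisimple)
    (h : ad K L x = n + s) (y z : L) : s ⁅y, z⁆ = ⁅s y, z⁆ + ⁅y, s z⁆ := by
  have key {μ : K} {w : L} (hw : w ∈ (ad K L x).maxGenEigenspace μ) : s w = μ • w := by
    refine End.apply_eq_of_mem_of_comm_of_isFinitelySemisimple_of_isNil hw ?_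
      hs.isFinitelySemisimple ?_
    · rw [h]; exact hc.add_left (Commute.refl s)
    · rwa [h, add_sub_cancel_right]
  have hy : y ∈ ⨆ μ, (ad K L x).maxGenEigenspace μ := by
    simp [End.iSup_maxGenEigenspace_eq_top]
  have hz : z ∈ ⨆ μ, (ad K L x).maxGenEigenspace μ := by
    simp [End.iSup_maxGenEigenspace_eq_top]
  induction hy using Submodule.iSup_induction' with
  | zero => simp
  | add y₁ y₂ _ _ h₁ h₂ => simp only [add_lie, map_add, h₁, h₂]; abel
  | mem μ y hy =>
    induction hz using Submodule.iSup_induction' with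
    | zero => simp
    | add z₁ z₂ _ _ h₁ h₂ => simp only [lie_add, map_add, h₁, h₂]; abel
    | mem ν z hz =>
      rw [key hy, key hz, key (LieModule.lie_mem_maxGenEigenspace_toEnd hy hz)]
      simp [add_smul]

lemma isSemisimple_ad_of_disjoint_of_isKilling [CharZero K] [IsAlgClosed K] [FiniteDimensional K L]
    [IsKilling K L] {x : L}
    (hx : Disjoint (LinearMap.ker (ad K L x)) (LinearMap.range (ad K L x))) :
    (ad K L x).IsSemisimple := by
  have ad_lie_eq (a b : L) : ad K L ⁅a, b⁆ = ad K L a * ad K L b - ad K L b * ad K L a := by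
    ext; simp
  obtain ⟨n, hn, s, hs, hn', hs', h⟩ := (ad K L x).exists_isNilpotent_isSemisimple
  have comm_n {t : End K L} (ht : Commute (ad K L x) t) : Commute n t :=
    Algebra.commute_of_mem_adjoin_singleton_of_commute hn ht.symm |>.symm
  have hc : Commute n s := comm_n (Algebra.commute_of_mem_adjoin_self hs)
  have leib := leibniz_of_isNilpotent_of_isSemisimple hc hn' hs' h
  have leib' (a b : L) : s ⁅a, b⁆ = ⁅a, s b⁆ - ⁅b, s a⁆ := by
    rw [leib, ← lie_skew b (s a), sub_neg_eq_add, add_comm]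
  let D : LieDerivation K L L := LieDerivation.ad K L x - ⟨s, leib'⟩
  obtain ⟨y, hy⟩ := LieDerivation.IsKilling.exists_eq_ad D
  have hyn : ad K L y = n := by
    ext z
    have h1 := DFunLike.congr_fun hy z
    have h2 := LinearMap.congr_fun h z
    simp [D] at h1 h2
    simp [h1, h2]
  have hK (z : L) : killingForm K L y z = 0 := by
    rw [killingForm_apply_apply, hyn]
    obtain ⟨a, ha, -, ⟨b, rfl⟩, rfl⟩ := Submodule.mem_sup.mp
      ((End.isCompl_ker_range_iff_disjoint.mpr hx).sup_eq_top ▸ Submodule.mem_top (x := z))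
    have hna : Commute n (ad K L a) := comm_n <| by
      rw [commute_iff_eq, ← sub_eq_zero, ← ad_lie_eq, ← ad_apply (R := K), LinearMap.mem_ker.mp ha,
        map_zero]
    have h1 : LinearMap.trace K L (n * ad K L a) = 0 :=
      (LinearMap.isNilpotent_trace_of_isNilpotent (hna.isNilpotent_mul_right hn')).eq_zero
    have h2 : LinearMap.trace K L (n * ad K L ⁅x, b⁆) = 0 := by
      have e := (comm_n (Commute.refl (ad K L x))).eq
      rw [ad_lie_eq, mul_sub, map_sub, ← mul_assoc, e, mul_assoc,
        LinearMap.trace_mul_comm, mul_assoc, sub_self]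
    rw [map_add, LinearMap.comp_add, map_add, ad_apply]
    exact (congr_arg₂ (· + ·) h1 h2).trans (add_zero 0)
  have hy0 : y = 0 := (IsKilling.killingForm_nondegenerate K L).1 y hK
  rw [hy0, map_zero] at hyn
  rwa [h, ← hyn, zero_add]

end

section

variable (R L : Type*) [CommRing R] [LieRing L] [LieAlgebra R L]

/-- The quotient of a reductive Lie algebra by its centre has trivial radical. -/
lemma hasTrivialRadical_quotient_center [IsNoetherian R L] [HasCentralRadical R L] :
    HasTrivialRadical R (L ⧸ center R L) := by
  set π := LieSubmodule.Quotient.mk' (center R L)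
  let φ : L →ₗ⁅R⁆ L ⧸ center R L :=
    { (π : L →ₗ[R] L ⧸ center R L) with map_lie' := fun {_ _} ↦ rfl }
  set J := radical R (L ⧸ center R L)
  set I := J.comap φ
  have hD (k : ℕ) :
      derivedSeriesOfIdeal R L k I ≤ (derivedSeriesOfIdeal R (L ⧸ center R L) k J).comap φ := by
    induction k with
    | zero => simp [I]
    | succ k ih =>
      rw [derivedSeriesOfIdeal_succ, derivedSeriesOfIdeal_succ]
      exact (LieSubmodule.mono_lie ih ih).trans (LieIdeal.comap_bracket_le φ)
  have hI : IsSolvable I := by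
    obtain ⟨k, hk⟩ := IsSolvable.solvable R J
    rw [LieIdeal.derivedSeries_eq_bot_iff] at hk
    refine IsSolvable.mk (R := R) (k := 1 + k) ((LieIdeal.derivedSeries_eq_bot_iff I _).mpr ?_)
    rw [derivedSeriesOfIdeal_add, eq_bot_iff, ← (abelian_iff_derived_one_eq_bot _).mp
      (inferInstance : IsLieAbelian (center R L))]
    refine derivedSeriesOfIdeal_mono (fun a ha ↦ ?_) 1
    have := hD k ha
    rw [hk, LieIdeal.mem_comap, LieSubmodule.mem_bot] at this
    exact (LieSubmodule.Quotient.mk_eq_zero _).mp this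
  rw [LieIdeal.solvable_iff_le_radical, radical_eq_center] at hI
  refine ⟨(LieSubmodule.eq_bot_iff _).mpr fun y hy ↦ ?_⟩
  obtain ⟨a, rfl⟩ := LieSubmodule.Quotient.surjective_mk' (center R L) y
  exact (LieSubmodule.Quotient.mk_eq_zero _).mpr (hI (LieIdeal.mem_comap.mpr hy))

end

lemma isSemisimple_ad_of_disjoint_of_hasCentralRadical {K L : Type*} [Field K] [CharZero K]
    [IsAlgClosed K] [LieRing L] [LieAlgebra K L] [FiniteDimensional K L] [HasCentralRadical K L]
    {x : L} (hx : Disjoint (LinearMap.ker (ad K L x)) (LinearMap.range (ad K L x))) :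
    (ad K L x).IsSemisimple := by
  have := hasTrivialRadical_quotient_center K L
  have : FiniteDimensional K (L ⧸ center K L) :=
    inferInstanceAs (FiniteDimensional K (L ⧸ (center K L).toSubmodule))
  let π : L →ₗ[K] L ⧸ center K L := LieSubmodule.Quotient.mk' (center K L)
  have hπ (y : L) : π y = 0 ↔ y ∈ center K L := LieSubmodule.Quotient.mk_eq_zero _
  have hcen {y : L} (hy : y ∈ center K L) : ⁅x, y⁆ = 0 := hy x
  refine End.isSemisimple_of_disjoint_of_semiconj (g := ad K (L ⧸ center K L) (π x)) π rfl
    (fun y hy ↦ hcen ((hπ y).mp hy)) (isSemisimple_ad_of_disjoint_of_isKilling ?_) hx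
  rw [Submodule.disjoint_def] at hx ⊢
  rintro - hker ⟨w, rfl⟩
  obtain ⟨y, rfl⟩ := LieSubmodule.Quotient.surjective_mk' (center K L) w
  have h1 : ⁅x, ⁅x, y⁆⁆ ∈ center K L := (hπ _).mp hker
  have h2 : ⁅x, ⁅x, y⁆⁆ = 0 := hx _ (hcen h1) ⟨⁅x, y⁆, rfl⟩
  have h3 : ⁅x, y⁆ = 0 := hx _ h2 ⟨y, rfl⟩
  change π ⁅x, y⁆ = 0
  rw [h3, map_zero]

end LieAlgebra


/-- For an element Λ of a finite-dimensional reductive Lie algebra (radical = center)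
over an algebraically closed field of characteristic 0, the following are equivalent:
(i) ad Λ is a semisimple endomorphism; (iii) ker(ad Λ) ∩ im(ad Λ) = 0;
(iv) g = ker(ad Λ) + im(ad Λ); (v) g = ker(ad Λ) ⊕ im(ad Λ). -/
theorem stmt4 {F : Type*} [Field F] [CharZero F] [IsAlgClosed F]
    {g : Type*} [LieRing g] [LieAlgebra F g] [FiniteDimensional F g]
    (hred : LieAlgebra.radical F g = LieAlgebra.center F g)
    (Λ : g) :
    ((LieAlgebra.ad F g Λ).IsSemisimple ↔
      LinearMap.ker (LieAlgebra.ad F g Λ) ⊓ LinearMap.range (LieAlgebra.ad F g Λ) = ⊥) ∧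
    ((LieAlgebra.ad F g Λ).IsSemisimple ↔
      LinearMap.ker (LieAlgebra.ad F g Λ) ⊔ LinearMap.range (LieAlgebra.ad F g Λ) = ⊤) ∧
    ((LieAlgebra.ad F g Λ).IsSemisimple ↔
      IsCompl (LinearMap.ker (LieAlgebra.ad F g Λ))
        (LinearMap.range (LieAlgebra.ad F g Λ))) := by
  have : LieAlgebra.HasCentralRadical F g := ⟨hred⟩
  have h : (LieAlgebra.ad F g Λ).IsSemisimple ↔
      Disjoint (LinearMap.ker (LieAlgebra.ad F g Λ)) (LinearMap.range (LieAlgebra.ad F g Λ)) :=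
    ⟨Module.End.IsSemisimple.disjoint_ker_range,
      LieAlgebra.isSemisimple_ad_of_disjoint_of_hasCentralRadical⟩
  rw [← disjoint_iff, ← codisjoint_iff, h]
  exact ⟨Iff.rfl, Module.End.isCompl_ker_range_iff_disjoint.symm.trans
    Module.End.isCompl_ker_range_iff_codisjoint, Module.End.isCompl_ker_range_iff_disjoint.symm⟩
end

section
/- Let g be a simple Lie algebra over an algebraically closed field of characteristic 0, with sl2-triple {f,2x,e} where f is a minimal nilpotent (ad(x)-eigenvalues -1,-1/2,0,1/2,1 with g_{±1} one-dimensional, g₁ = F·e, g_{-1} = F·f). Then the element f + z·e of the Lie algebra g((z⁻¹)) = g ⊗ F((z⁻¹)) is ad-semisimple, with Ker ad(f+ze) = g₀^f((z⁻¹)) ⊕ F(f+ze)((z⁻¹)) and Im ad(f+ze) = g_{-1/2}((z⁻¹)) ⊕ Fx((z⁻¹)) ⊕ g_{1/2}((z⁻¹)) ⊕ F(f-ze)((z⁻¹)), and g((z⁻¹)) = Ker ad(f+ze) ⊕ Im ad(f+ze). -/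
open scoped TensorProduct

attribute [-instance] HahnSeries.instModule

set_option maxHeartbeats 1000000

theorem Module.End.aeval_apply_of_apply_eq_smul {K V : Type*} [Field K] [AddCommGroup V]
    [Module K V] {T : Module.End K V} {μ : K} {y : V} (h : T y = μ • y) (p : Polynomial K) :
    Polynomial.aeval T p y = p.eval μ • y := by
  rcases eq_or_ne y 0 with rfl | hy
  · simp
  · exact Module.End.aeval_apply_of_hasEigenvector (Module.End.hasEigenvector_iff.2
      ⟨Module.End.mem_eigenspace_iff.2 h, hy⟩)

/-- If `T` vanishes on `Hk`, preserves the span of `S`, has square `a` or `b` (distinct and nonzero)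
on each element of `S`, and `Hk` and `S` span everything, then `T` is semisimple with kernel `Hk`
and range the span of `S`. -/
theorem Module.End.isSemisimple_ker_range_of_sq {K V : Type*} [Field K] [CharZero K]
    [AddCommGroup V] [Module K V] (T : Module.End K V) {a b : K} (ha : a ≠ 0) (hb : b ≠ 0)
    (hab : a ≠ b) (Hk : Submodule K V) (S : Set V) (hk : Hk ≤ LinearMap.ker T)
    (hS : ∀ w ∈ S, T w ∈ Submodule.span K S)
    (hsq : ∀ w ∈ S, T (T w) = a • w ∨ T (T w) = b • w)
    (htop : Hk ⊔ Submodule.span K S = ⊤) :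
    T.IsSemisimple ∧ LinearMap.ker T = Hk ∧ LinearMap.range T = Submodule.span K S ∧
      IsCompl Hk (Submodule.span K S) := by
  open Polynomial in
  set p : K[X] := (X ^ 2 - C a) * (X ^ 2 - C b) with hp
  have hpS : Submodule.span K S ≤ LinearMap.ker (aeval T p) := by
    refine Submodule.span_le.2 fun w hw => ?_
    rw [SetLike.mem_coe, LinearMap.mem_ker]
    have key (c : K) : aeval T (X ^ 2 - C c) w = T (T w) - c • w := by
      simp [pow_two, Algebra.algebraMap_eq_smul_one]
    rcases hsq w hw with h | h
    · rw [hp, mul_comm, map_mul, Module.End.mul_apply, key, h, sub_self, map_zero]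
    · rw [hp, map_mul, Module.End.mul_apply, key, h, sub_self, map_zero]
  have hdisj : ∀ w ∈ Submodule.span K S, T w = 0 → w = 0 := by
    intro w hw h0
    have h1 := Module.End.aeval_apply_of_apply_eq_smul (μ := (0 : K))
      (h0.trans (zero_smul K w).symm) p
    rw [LinearMap.mem_ker.1 (hpS hw)] at h1
    have h2 : p.eval 0 ≠ 0 := by simp [hp, ha, hb]
    exact (smul_eq_zero.1 h1.symm).resolve_left h2
  have hdec : ∀ w, ∃ k ∈ Hk, ∃ r ∈ Submodule.span K S, k + r = w := fun w =>
    Submodule.mem_sup.1 (htop ▸ Submodule.mem_top)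
  have hle : Submodule.span K S ≤ (Submodule.span K S).comap T := Submodule.span_le.2 hS
  refine ⟨?_, le_antisymm (fun w hw => ?_) hk, le_antisymm ?_ (Submodule.span_le.2 ?_),
    Submodule.disjoint_def.2 fun w hw hw' => hdisj w hw' (hk hw), codisjoint_iff.2 htop⟩
  · have hsep : (X * p : K[X]).Separable := by
      have h2 : ((2 : ℕ) : K) ≠ 0 := by norm_num
      have hco : IsCoprime (X ^ 2 - C a : K[X]) (X ^ 2 - C b) := by
        refine ⟨C (b - a)⁻¹, -C (b - a)⁻¹, ?_⟩
        have : C (b - a)⁻¹ * (C b - C a) = (1 : K[X]) := by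
          rw [← C_sub, ← C_mul, inv_mul_cancel₀ (sub_ne_zero.2 hab.symm), C_1]
        linear_combination this
      have hX (c : K) (hc : c ≠ 0) : IsCoprime (X : K[X]) (X ^ 2 - C c) := by
        refine ⟨C c⁻¹ * X, -C c⁻¹, ?_⟩
        have : C c⁻¹ * C c = (1 : K[X]) := by
          rw [← C_mul, inv_mul_cancel₀ hc, C_1]
        linear_combination this
      exact separable_X.mul ((separable_X_pow_sub_C a h2 ha).mul
        (separable_X_pow_sub_C b h2 hb) hco) ((hX a ha).mul_right (hX b hb))
    refine Module.End.isSemisimple_of_squarefree_aeval_eq_zero hsep.squarefree ?_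
    ext w
    obtain ⟨k, hk', r, hr, rfl⟩ := hdec w
    have h1 : aeval T (X * p) k = 0 := by
      rw [mul_comm, map_mul, Module.End.mul_apply, aeval_X, LinearMap.mem_ker.1 (hk hk'), map_zero]
    have h2 : aeval T (X * p) r = 0 := by
      rw [map_mul, Module.End.mul_apply, LinearMap.mem_ker.1 (hpS hr), map_zero]
    rw [map_add, h1, h2, add_zero, LinearMap.zero_apply]
  · obtain ⟨k, hk', r, hr, rfl⟩ := hdec w
    rw [LinearMap.mem_ker, map_add, LinearMap.mem_ker.1 (hk hk'), zero_add] at hw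
    rwa [hdisj r hr hw, add_zero]
  · rintro _ ⟨w, rfl⟩
    obtain ⟨k, hk', r, hr, rfl⟩ := hdec w
    rw [map_add, LinearMap.mem_ker.1 (hk hk'), zero_add]
    exact hle hr
  · intro w hw
    rcases hsq w hw with h | h
    · exact ⟨a⁻¹ • T w, by rw [map_smul, h, inv_smul_smul₀ ha]⟩
    · exact ⟨b⁻¹ • T w, by rw [map_smul, h, inv_smul_smul₀ hb]⟩

theorem TensorProduct.tmul_smul_eq_algebraMap_smul {R A M : Type*} [CommRing R] [CommRing A]
    [Algebra R A] [AddCommGroup M] [Module R M] (a : A) (c : R) (y : M) :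
    a ⊗ₜ[R] (c • y) = algebraMap R A c • (a ⊗ₜ[R] y) := by
  rw [TensorProduct.tmul_smul, algebraMap_smul]

section MinimalGrading

variable {F : Type*} [Field F] {g : Type*} [LieRing g] [LieAlgebra F g] {e x f : g}

theorem lie_apply_weight {y w : g} {μ ν : F} (hy : ⁅x, y⁆ = μ • y) (hw : ⁅x, w⁆ = ν • w) :
    ⁅x, ⁅y, w⁆⁆ = (μ + ν) • ⁅y, w⁆ := by
  rw [leibniz_lie, hy, hw, smul_lie, lie_smul, add_smul]

theorem aeval_ad_apply_of_grading
    (hxe : ⁅x, e⁆ = e) (hxf : ⁅x, f⁆ = -f)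
    (hmin : ∀ y : g, ∃ (c₁ c₂ : F) (u a v : g),
      ⁅x, u⁆ = (-(1 / 2 : F)) • u ∧ ⁅x, a⁆ = 0 ∧ ⁅x, v⁆ = (1 / 2 : F) • v ∧
      y = c₁ • f + u + a + v + c₂ • e)
    {y : g} {μ : F} (hy : ⁅x, y⁆ = μ • y) :
    ∃ c₁ c₂ : F, ∀ p : Polynomial F, p.eval (-(1 / 2)) = 0 → p.eval 0 = 0 → p.eval (1 / 2) = 0 →
      p.eval μ • y = (p.eval (-1) * c₁) • f + (p.eval 1 * c₂) • e := by
  obtain ⟨c₁, c₂, u, a, v, hu, ha, hv, h⟩ := hmin y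
  refine ⟨c₁, c₂, fun p hp₁ hp₂ hp₃ => ?_⟩
  have key {w : g} {ν : F} (hw : ⁅x, w⁆ = ν • w) :
      Polynomial.aeval (LieAlgebra.ad F g x) p w = p.eval ν • w :=
    Module.End.aeval_apply_of_apply_eq_smul hw p
  rw [← key hy, h, map_add, map_add, map_add, map_add, map_smul, map_smul, key hu, key hv,
    key (ha.trans (zero_smul F a).symm), key (hxe.trans (one_smul F e).symm),
    key (ν := -1) (hxf.trans (by simp)), hp₁, hp₂, hp₃]
  module

open Polynomial in
theorem eq_zero_of_weight
    (hxe : ⁅x, e⁆ = e) (hxf : ⁅x, f⁆ = -f)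
    (hmin : ∀ y : g, ∃ (c₁ c₂ : F) (u a v : g),
      ⁅x, u⁆ = (-(1 / 2 : F)) • u ∧ ⁅x, a⁆ = 0 ∧ ⁅x, v⁆ = (1 / 2 : F) • v ∧
      y = c₁ • f + u + a + v + c₂ • e)
    {y : g} {μ : F} (hy : ⁅x, y⁆ = μ • y)
    (hμ : μ * (μ - 1 / 2) * (μ + 1 / 2) * (μ + 1) * (μ - 1) ≠ 0) : y = 0 := by
  obtain ⟨c₁, c₂, h⟩ := aeval_ad_apply_of_grading hxe hxf hmin hy
  have := h (X * (X - C (1 / 2)) * (X + C (1 / 2)) * (X + C 1) * (X - C 1))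
    (by simp) (by simp) (by simp)
  simp only [eval_mul, eval_X, eval_sub, eval_add, eval_C, neg_add_cancel, sub_self, mul_zero,
    zero_mul, zero_smul, zero_add] at this
  exact (smul_eq_zero.1 this).resolve_left hμ

variable [CharZero F]

open Polynomial in
theorem exists_smul_of_weight_neg_one
    (hxe : ⁅x, e⁆ = e) (hxf : ⁅x, f⁆ = -f)
    (hmin : ∀ y : g, ∃ (c₁ c₂ : F) (u a v : g),
      ⁅x, u⁆ = (-(1 / 2 : F)) • u ∧ ⁅x, a⁆ = 0 ∧ ⁅x, v⁆ = (1 / 2 : F) • v ∧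
      y = c₁ • f + u + a + v + c₂ • e)
    {y : g} (hy : ⁅x, y⁆ = (-1 : F) • y) : ∃ c : F, y = c • f := by
  obtain ⟨c₁, c₂, h⟩ := aeval_ad_apply_of_grading hxe hxf hmin hy
  have := h (X * (X - C (1 / 2)) * (X + C (1 / 2)) * (X - C 1)) (by simp) (by simp) (by simp)
  simp only [eval_mul, eval_X, eval_sub, eval_add, eval_C, sub_self, mul_zero, zero_mul,
    zero_smul, add_zero, mul_smul _ c₁] at this
  exact ⟨c₁, smul_right_injective g (by norm_num) this⟩

open Polynomial in
theorem exists_smul_of_weight_one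
    (hxe : ⁅x, e⁆ = e) (hxf : ⁅x, f⁆ = -f)
    (hmin : ∀ y : g, ∃ (c₁ c₂ : F) (u a v : g),
      ⁅x, u⁆ = (-(1 / 2 : F)) • u ∧ ⁅x, a⁆ = 0 ∧ ⁅x, v⁆ = (1 / 2 : F) • v ∧
      y = c₁ • f + u + a + v + c₂ • e)
    {y : g} (hy : ⁅x, y⁆ = (1 : F) • y) : ∃ c : F, y = c • e := by
  obtain ⟨c₁, c₂, h⟩ := aeval_ad_apply_of_grading hxe hxf hmin hy
  have := h (X * (X - C (1 / 2)) * (X + C (1 / 2)) * (X + C 1)) (by simp) (by simp) (by simp)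
  simp only [eval_mul, eval_X, eval_sub, eval_add, eval_C, neg_add_cancel, mul_zero, zero_mul,
    zero_smul, zero_add, mul_smul _ c₂] at this
  exact ⟨c₂, smul_right_injective g (by norm_num) this⟩

/-- The zero weight space is the sum of `F x` and the centralizer of the triple in it. -/
theorem exists_sub_smul_centralizes
    (hxe : ⁅x, e⁆ = e) (hxf : ⁅x, f⁆ = -f)
    (hmin : ∀ y : g, ∃ (c₁ c₂ : F) (u a v : g),
      ⁅x, u⁆ = (-(1 / 2 : F)) • u ∧ ⁅x, a⁆ = 0 ∧ ⁅x, v⁆ = (1 / 2 : F) • v ∧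
      y = c₁ • f + u + a + v + c₂ • e)
    {a : g} (ha : ⁅x, a⁆ = 0) : ∃ c : F, ⁅x, a - c • x⁆ = 0 ∧ ⁅f, a - c • x⁆ = 0 := by
  have h := lie_apply_weight (F := F) (μ := -1) (ν := 0) (hxf.trans (by simp))
    (ha.trans (by simp))
  obtain ⟨c, hc⟩ := exists_smul_of_weight_neg_one hxe hxf hmin (by rwa [add_zero] at h)
  refine ⟨c, by simp [ha], ?_⟩
  rw [lie_sub, lie_smul, hc, ← lie_skew, hxf, neg_neg, sub_self]

theorem lie_eq_zero_of_centralizes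
    (hef : ⁅e, f⁆ = (2 : F) • x) (hxe : ⁅x, e⁆ = e) (hxf : ⁅x, f⁆ = -f)
    (hmin : ∀ y : g, ∃ (c₁ c₂ : F) (u a v : g),
      ⁅x, u⁆ = (-(1 / 2 : F)) • u ∧ ⁅x, a⁆ = 0 ∧ ⁅x, v⁆ = (1 / 2 : F) • v ∧
      y = c₁ • f + u + a + v + c₂ • e)
    {a : g} (ha : ⁅x, a⁆ = 0) (hfa : ⁅f, a⁆ = 0) : ⁅e, a⁆ = 0 := by
  have h := lie_apply_weight (F := F) (μ := 1) (ν := 0) (hxe.trans (by simp))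
    (ha.trans (by simp))
  obtain ⟨d, hd⟩ := exists_smul_of_weight_one hxe hxf hmin (by rwa [add_zero] at h)
  have h1 : ⁅⁅e, f⁆, a⁆ = 0 := by rw [hef, smul_lie, ha, smul_zero]
  rw [lie_lie, hfa, lie_zero, zero_sub, neg_eq_zero, hd, lie_smul, ← lie_skew, hef, smul_neg,
    neg_eq_zero, smul_comm, smul_eq_zero] at h1
  have h2 := h1.resolve_left two_ne_zero
  rw [hd, ← hxe, ← smul_lie, h2, zero_lie]

end MinimalGrading

/-- For a minimal nilpotent f with s = e, the element f + ze of g((z⁻¹)) is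
ad-semisimple, its kernel is g₀^f((z⁻¹)) ⊕ F(f+ze)((z⁻¹)), its image is
g_{-1/2}((z⁻¹)) ⊕ Fx((z⁻¹)) ⊕ g_{1/2}((z⁻¹)) ⊕ F(f-ze)((z⁻¹)), and
g((z⁻¹)) = Ker ⊕ Im. -/
theorem stmt7 {F : Type*} [Field F] [CharZero F] [IsAlgClosed F]
    {g : Type*} [LieRing g] [LieAlgebra F g] [FiniteDimensional F g]
    [LieAlgebra.IsSimple F g]
    (e x f : g)
    (hef : ⁅e, f⁆ = (2 : F) • x) (hxe : ⁅x, e⁆ = e) (hxf : ⁅x, f⁆ = -f)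
    (hmin : ∀ y : g, ∃ (c₁ c₂ : F) (u a v : g),
      ⁅x, u⁆ = (-(1 / 2 : F)) • u ∧ ⁅x, a⁆ = 0 ∧ ⁅x, v⁆ = (1 / 2 : F) • v ∧
      y = c₁ • f + u + a + v + c₂ • e)
    (z : LaurentSeries F) (hz : z = HahnSeries.single (-1) 1)
    (Λ : LaurentSeries F ⊗[F] g)
    (hΛ : Λ = (1 : LaurentSeries F) ⊗ₜ[F] f + z ⊗ₜ[F] e)
    (Hk Hr : Submodule (LaurentSeries F) (LaurentSeries F ⊗[F] g))
    (hHk : Hk = Submodule.span (LaurentSeries F)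
      ({w | ∃ a : g, ⁅x, a⁆ = 0 ∧ ⁅f, a⁆ = 0 ∧ w = (1 : LaurentSeries F) ⊗ₜ[F] a}
        ∪ {Λ}))
    (hHr : Hr = Submodule.span (LaurentSeries F)
      ({w | ∃ u : g, ⁅x, u⁆ = (-(1 / 2 : F)) • u ∧ w = (1 : LaurentSeries F) ⊗ₜ[F] u}
        ∪ {(1 : LaurentSeries F) ⊗ₜ[F] x}
        ∪ {w | ∃ v : g, ⁅x, v⁆ = (1 / 2 : F) • v ∧ w = (1 : LaurentSeries F) ⊗ₜ[F] v}
        ∪ {(1 : LaurentSeries F) ⊗ₜ[F] f - z ⊗ₜ[F] e})) :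
    (LieAlgebra.ad (LaurentSeries F) (LaurentSeries F ⊗[F] g) Λ).IsSemisimple ∧
    LinearMap.ker (LieAlgebra.ad (LaurentSeries F) (LaurentSeries F ⊗[F] g) Λ) = Hk ∧
    LinearMap.range (LieAlgebra.ad (LaurentSeries F) (LaurentSeries F ⊗[F] g) Λ) = Hr ∧
    IsCompl Hk Hr := by
  have : CharZero (LaurentSeries F) :=
    charZero_of_injective_algebraMap (algebraMap F (LaurentSeries F)).injective
  have hz0 : z ≠ 0 := by rw [hz]; simp
  have hbr (a b : LaurentSeries F) (y w : g) :
      ⁅a ⊗ₜ[F] y, b ⊗ₜ[F] w⁆ = (a * b) ⊗ₜ[F] ⁅y, w⁆ :=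
    LieAlgebra.ExtendScalars.bracket_tmul F (LaurentSeries F) g g a b y w
  have hs (a : LaurentSeries F) (y : g) :
      a ⊗ₜ[F] y = a • ((1 : LaurentSeries F) ⊗ₜ[F] y) := by
    rw [TensorProduct.smul_tmul', smul_eq_mul, mul_one]
  have hfx : ⁅f, x⁆ = f := by rw [← lie_skew, hxf, neg_neg]
  have hex : ⁅e, x⁆ = -e := by rw [← lie_skew, hxe]
  have hfe : ⁅f, e⁆ = -((2 : F) • x) := by rw [← lie_skew, hef]
  have hxf' : ⁅x, f⁆ = (-1 : F) • f := hxf.trans (by simp)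
  have hxe' : ⁅x, e⁆ = (1 : F) • e := hxe.trans (by simp)
  have h2x : (1 : LaurentSeries F) ⊗ₜ[F] ((2 : F) • x)
      = (2 : LaurentSeries F) • ((1 : LaurentSeries F) ⊗ₜ[F] x) := by
    rw [two_smul, two_smul, TensorProduct.tmul_add]
  have hfu {u : g} (hu : ⁅x, u⁆ = (-(1 / 2 : F)) • u) : ⁅f, u⁆ = 0 :=
    eq_zero_of_weight hxe hxf hmin (lie_apply_weight hxf' hu) (by norm_num)
  have hev {v : g} (hv : ⁅x, v⁆ = (1 / 2 : F) • v) : ⁅e, v⁆ = 0 :=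
    eq_zero_of_weight hxe hxf hmin (lie_apply_weight hxe' hv) (by norm_num)
  have hfeu {u : g} (hu : ⁅x, u⁆ = (-(1 / 2 : F)) • u) : ⁅f, ⁅e, u⁆⁆ = u := by
    rw [leibniz_lie, hfe, hfu hu, lie_zero, add_zero, neg_lie, smul_lie, hu]
    module
  have hefv {v : g} (hv : ⁅x, v⁆ = (1 / 2 : F) • v) : ⁅e, ⁅f, v⁆⁆ = v := by
    rw [leibniz_lie, hef, hev hv, lie_zero, add_zero, smul_lie, hv]
    module
  set T := LieAlgebra.ad (LaurentSeries F) (LaurentSeries F ⊗[F] g) Λ with hT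
  have hT1 (y : g) : T ((1 : LaurentSeries F) ⊗ₜ[F] y)
      = (1 : LaurentSeries F) ⊗ₜ[F] ⁅f, y⁆ + z • ((1 : LaurentSeries F) ⊗ₜ[F] ⁅e, y⁆) := by
    rw [hT, LieAlgebra.ad_apply, hΛ, add_lie, hbr, hbr, mul_one, mul_one, hs z]
  have hTu {u : g} (hu : ⁅x, u⁆ = (-(1 / 2 : F)) • u) : T ((1 : LaurentSeries F) ⊗ₜ[F] u)
      = z • ((1 : LaurentSeries F) ⊗ₜ[F] ⁅e, u⁆) := by
    rw [hT1, hfu hu, TensorProduct.tmul_zero, zero_add]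
  have hTv {v : g} (hv : ⁅x, v⁆ = (1 / 2 : F) • v) : T ((1 : LaurentSeries F) ⊗ₜ[F] v)
      = (1 : LaurentSeries F) ⊗ₜ[F] ⁅f, v⁆ := by
    rw [hT1, hev hv, TensorProduct.tmul_zero, smul_zero, add_zero]
  have hTx : T ((1 : LaurentSeries F) ⊗ₜ[F] x)
      = (1 : LaurentSeries F) ⊗ₜ[F] f - z ⊗ₜ[F] e := by
    rw [hT1, hfx, hex, TensorProduct.tmul_neg, smul_neg, ← hs, sub_eq_add_neg]
  have hTm : T ((1 : LaurentSeries F) ⊗ₜ[F] f - z ⊗ₜ[F] e)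
      = (4 * z) • ((1 : LaurentSeries F) ⊗ₜ[F] x) := by
    rw [hs z, map_sub, map_smul, hT1, hT1, lie_self, lie_self, hef, hfe, TensorProduct.tmul_neg,
      h2x, TensorProduct.tmul_zero, zero_add, smul_zero, add_zero, smul_neg, sub_neg_eq_add,
      smul_smul, ← add_smul]
    congr 1
    ring
  have hwu {u : g} (hu : ⁅x, u⁆ = (-(1 / 2 : F)) • u) : ⁅x, ⁅e, u⁆⁆ = (1 / 2 : F) • ⁅e, u⁆ := by
    rw [lie_apply_weight hxe' hu]
    norm_num
  have hwv {v : g} (hv : ⁅x, v⁆ = (1 / 2 : F) • v) :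
      ⁅x, ⁅f, v⁆⁆ = (-(1 / 2 : F)) • ⁅f, v⁆ := by
    rw [lie_apply_weight hxf' hv]
    norm_num
  have hz4 : 4 * z ≠ 0 := mul_ne_zero (by norm_num) hz0
  have hne : z ≠ 4 * z := by
    intro h
    have h3 : (3 : LaurentSeries F) * z = 0 := by linear_combination -h
    exact hz0 ((mul_eq_zero.1 h3).resolve_left three_ne_zero)
  rw [hHr]
  refine Module.End.isSemisimple_ker_range_of_sq T hz0 hz4 hne Hk _ ?_ ?_ ?_ ?_
  · rw [hHk, Submodule.span_le]
    rintro w (⟨a, hxa, hfa, rfl⟩ | rfl)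
    · rw [SetLike.mem_coe, LinearMap.mem_ker, hT1, hfa,
        lie_eq_zero_of_centralizes hef hxe hxf hmin hxa hfa]
      simp
    · rw [SetLike.mem_coe, LinearMap.mem_ker, hT, LieAlgebra.ad_apply, lie_self]
  · rintro w (((⟨u, hu, rfl⟩ | rfl) | ⟨v, hv, rfl⟩) | rfl)
    · rw [hTu hu]
      exact Submodule.smul_mem _ _ (Submodule.subset_span (.inl (.inr ⟨_, hwu hu, rfl⟩)))
    · rw [hTx]
      exact Submodule.subset_span (.inr rfl)
    · rw [hTv hv]
      exact Submodule.subset_span (.inl (.inl (.inl ⟨_, hwv hv, rfl⟩)))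
    · rw [hTm]
      exact Submodule.smul_mem _ _ (Submodule.subset_span (.inl (.inl (.inr rfl))))
  · rintro w (((⟨u, hu, rfl⟩ | rfl) | ⟨v, hv, rfl⟩) | rfl)
    · left
      rw [hTu hu, map_smul, hTv (hwu hu), hfeu hu]
    · right
      rw [hTx, hTm]
    · left
      rw [hTv hv, hTu (hwv hv), hefv hv]
    · right
      rw [hTm, map_smul, hTx]
  · rw [← hHr]
    have hkmem {w} (hw : w ∈ Hk) : w ∈ Hk ⊔ Hr := Submodule.mem_sup_left hw
    have hrmem {w} (hw : w ∈ Hr) : w ∈ Hk ⊔ Hr := Submodule.mem_sup_right hw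
    have hΛm : Λ ∈ Hk ⊔ Hr := hkmem (hHk ▸ Submodule.subset_span (.inr rfl))
    have hmm : (1 : LaurentSeries F) ⊗ₜ[F] f - z ⊗ₜ[F] e ∈ Hk ⊔ Hr :=
      hrmem (hHr ▸ Submodule.subset_span (.inr rfl))
    have hxm : (1 : LaurentSeries F) ⊗ₜ[F] x ∈ Hk ⊔ Hr :=
      hrmem (hHr ▸ Submodule.subset_span (.inl (.inl (.inr rfl))))
    have hfm : (1 : LaurentSeries F) ⊗ₜ[F] f ∈ Hk ⊔ Hr := by
      have h : (1 : LaurentSeries F) ⊗ₜ[F] f = (2 : LaurentSeries F)⁻¹ •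
          (Λ + ((1 : LaurentSeries F) ⊗ₜ[F] f - z ⊗ₜ[F] e)) := by
        rw [eq_inv_smul_iff₀ two_ne_zero, hΛ, two_smul]
        abel
      rw [h]
      exact Submodule.smul_mem _ _ (Submodule.add_mem _ hΛm hmm)
    have hem : (1 : LaurentSeries F) ⊗ₜ[F] e ∈ Hk ⊔ Hr := by
      have h : (1 : LaurentSeries F) ⊗ₜ[F] e = z⁻¹ •
          (Λ - (1 : LaurentSeries F) ⊗ₜ[F] f) := by
        rw [eq_inv_smul_iff₀ hz0, hΛ, ← hs]
        abel
      rw [h]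
      exact Submodule.smul_mem _ _ (Submodule.sub_mem _ hΛm hfm)
    have hsm (c : F) {y : g} (hy : (1 : LaurentSeries F) ⊗ₜ[F] y ∈ Hk ⊔ Hr) :
        (1 : LaurentSeries F) ⊗ₜ[F] (c • y) ∈ Hk ⊔ Hr := by
      rw [TensorProduct.tmul_smul_eq_algebraMap_smul]
      exact Submodule.smul_mem _ _ hy
    refine eq_top_iff.2 fun t _ => ?_
    induction t using TensorProduct.induction_on with
    | zero => exact Submodule.zero_mem _
    | add t₁ t₂ h₁ h₂ => exact Submodule.add_mem _ (h₁ trivial) (h₂ trivial)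
    | tmul k y =>
      rw [hs]
      refine Submodule.smul_mem _ _ ?_
      obtain ⟨c₁, c₂, u, a, v, hu, ha, hv, rfl⟩ := hmin y
      obtain ⟨c, hxa, hfa⟩ := exists_sub_smul_centralizes hxe hxf hmin ha
      have ham : (1 : LaurentSeries F) ⊗ₜ[F] a ∈ Hk ⊔ Hr := by
        rw [← sub_add_cancel a (c • x), TensorProduct.tmul_add]
        exact Submodule.add_mem _
          (hkmem (hHk ▸ Submodule.subset_span (.inl ⟨_, hxa, hfa, rfl⟩))) (hsm c hxm)
      simp only [TensorProduct.tmul_add]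
      refine Submodule.add_mem _ (Submodule.add_mem _ (Submodule.add_mem _ (Submodule.add_mem _
        (hsm c₁ hfm) (hrmem ?_)) ham) (hrmem ?_)) (hsm c₂ hem)
      · exact hHr ▸ Submodule.subset_span (.inl (.inl (.inl ⟨u, hu, rfl⟩)))
      · exact hHr ▸ Submodule.subset_span (.inl (.inr ⟨v, hv, rfl⟩))
end

section
/- Let g be a simple Lie algebra of type C_n (n ≥ 2) with minimal nilpotent sl2-triple {f,2x,e}. Then there is no element s ∈ g_{1/2} such that f + s is a semisimple element of g. -/
section

open Module

section SymplecticForm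

variable {F V : Type*} [Field F] [AddCommGroup V] [Module F V]

/-- The endomorphism `y ↦ ω(w, y) u + ω(u, y) w` attached to a bilinear form `ω`. For an alternating
form this is the image of `u * w` under the identification of `Sym² V` with `𝔰𝔭(V)`. -/
def symmRankTwo (ω : V →ₗ[F] V →ₗ[F] F) (u w : V) : End F V :=
  (ω w).smulRight u + (ω u).smulRight w

@[simp]
theorem symmRankTwo_apply (ω : V →ₗ[F] V →ₗ[F] F) (u w y : V) :
    symmRankTwo ω u w y = ω w y • u + ω u y • w := by
  simp [symmRankTwo]

theorem symmRankTwo_skew {ω : V →ₗ[F] V →ₗ[F] F} (hω : ω.IsAlt) (u w a b : V) :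
    ω (symmRankTwo ω u w a) b = -ω a (symmRankTwo ω u w b) := by
  simp only [symmRankTwo_apply, map_add, map_smul, LinearMap.add_apply, LinearMap.smul_apply,
    smul_eq_mul]
  rw [← hω.neg u a, ← hω.neg w a]
  ring

theorem lie_symmRankTwo {ω : V →ₗ[F] V →ₗ[F] F} {x : End F V}
    (hx : ∀ a b, ω (x a) b = -ω a (x b)) {u w : V} {a b : F} (hu : x u = a • u) (hw : x w = b • w) :
    ⁅x, symmRankTwo ω u w⁆ = (a + b) • symmRankTwo ω u w := by
  ext y
  have h1 : ω u (x y) = -(a * ω u y) := by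
    rw [← neg_eq_iff_eq_neg, ← hx, hu]; simp
  have h2 : ω w (x y) = -(b * ω w y) := by
    rw [← neg_eq_iff_eq_neg, ← hx, hw]; simp
  simp only [LieRing.of_associative_ring_bracket, LinearMap.sub_apply, End.mul_apply,
    symmRankTwo_apply, map_add, map_smul, hu, hw, h1, h2, LinearMap.smul_apply]
  module

theorem form_eq_zero_of_weights {ω : V →ₗ[F] V →ₗ[F] F} {x : End F V}
    (hx : ∀ a b, ω (x a) b = -ω a (x b)) {u w : V} {a b : F} (hu : x u = a • u) (hw : x w = b • w)
    (hab : a + b ≠ 0) : ω u w = 0 := by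
  have h := hx u w
  rw [hu, hw] at h
  simp only [map_smul, LinearMap.smul_apply, smul_eq_mul] at h
  exact (mul_eq_zero.1 (by linear_combination h : (a + b) * ω u w = 0)).resolve_left hab

theorem symmRankTwo_self_ne_zero [CharZero F] {ω : V →ₗ[F] V →ₗ[F] F} (hnd : ω.SeparatingLeft)
    {v : V} (hv : v ≠ 0) : symmRankTwo ω v v ≠ 0 := by
  intro h
  refine hv (hnd v fun y ↦ ?_)
  have h1 := LinearMap.congr_fun h y
  rw [symmRankTwo_apply, ← two_smul F, LinearMap.zero_apply] at h1
  simpa [hv] using h1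

end SymplecticForm

/-- If `f` annihilates itself through every power of the nilpotent `s`, then `f + s` is nilpotent. -/
theorem isNilpotent_add_of_mul_pow_mul_eq_zero {R : Type*} [Ring R] {f s : R}
    (hfs : ∀ k : ℕ, f * s ^ k * f = 0) (hs : IsNilpotent s) : IsNilpotent (f + s) := by
  obtain ⟨N, hN⟩ := hs
  have h1 : ∀ k, f * (f + s) ^ k = f * s ^ k := by
    intro k
    induction k with
    | zero => simp
    | succ k ih => rw [pow_succ, ← mul_assoc, ih, mul_add, hfs, zero_add, mul_assoc, ← pow_succ]
  have h2 : ∀ j, (f + s) ^ (j + N) = s ^ j * (f + s) ^ N := by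
    intro j
    induction j with
    | zero => simp
    | succ j ih =>
      have h3 : f * (f + s) ^ (j + N) = 0 := by rw [h1, pow_add, hN]; simp
      rw [add_right_comm, pow_succ', add_mul, h3, zero_add, ih, ← mul_assoc, ← pow_succ']
  exact ⟨N + N, by rw [h2, hN, zero_mul]⟩

attribute [local instance] LieRing.ofAssociativeRing

section Eigenvalues

variable {F : Type*} [Field F]

theorem lie_pow_eq_smul {A : Type*} [Ring A] [Algebra F A] {x s : A} {c : F}
    (h : ⁅x, s⁆ = c • s) (k : ℕ) : ⁅x, s ^ k⁆ = (k * c) • s ^ k := by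
  simp only [LieRing.of_associative_ring_bracket] at *
  induction k with
  | zero => simp
  | succ k ih =>
    have h1 : x * s ^ (k + 1) - s ^ (k + 1) * x =
        (x * s ^ k - s ^ k * x) * s + s ^ k * (x * s - s * x) := by
      rw [pow_succ]; noncomm_ring
    rw [h1, ih, h, pow_succ, smul_mul_assoc, mul_smul_comm]
    push_cast
    module

theorem isNilpotent_of_lie_eq_smul [CharZero F] {A : Type*} [Ring A] [Algebra F A]
    [FiniteDimensional F A] {x s : A} {c : F} (hc : c ≠ 0)
    (h : ⁅x, s⁆ = c • s) : IsNilpotent s := by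
  by_contra hs
  have hne : ∀ k, s ^ k ≠ 0 := fun k hk ↦ hs ⟨k, hk⟩
  have hinj : Function.Injective fun k : ℕ ↦ (k * c : F) := fun a b hab ↦ by
    simpa [hc] using hab
  refine Set.infinite_range_of_injective hinj
    ((LieAlgebra.ad F A x).finite_hasEigenvalue.subset ?_)
  rintro _ ⟨k, rfl⟩
  refine End.hasEigenvalue_of_hasEigenvector (x := s ^ k) ⟨?_, hne k⟩
  rw [End.mem_eigenspace_iff, LieAlgebra.ad_apply, lie_pow_eq_smul h]

variable {V : Type*} [AddCommGroup V] [Module F V] [FiniteDimensional F V]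

theorem exists_hasEigenvalue_ne_zero [IsAlgClosed F] {x : End F V} (hx : ¬ IsNilpotent x) :
    ∃ μ : F, μ ≠ 0 ∧ x.HasEigenvalue μ := by
  by_contra! h
  apply hx
  rw [LinearMap.isNilpotent_iff_charpoly]
  have hr : ∀ a ∈ x.charpoly.roots, a = 0 := by
    intro a ha
    by_contra ha0
    exact h a ha0 ((End.hasEigenvalue_iff_isRoot_charpoly x a).2 (Polynomial.isRoot_of_mem_roots ha))
  have hsp := IsAlgClosed.splits x.charpoly
  have h1 := hsp.eq_prod_roots_of_monic x.charpoly_monic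
  have h2 : x.charpoly.roots.card = finrank F V := by
    rw [← hsp.natDegree_eq_card_roots, x.charpoly_natDegree]
  rw [Multiset.eq_replicate_of_mem hr, h2] at h1
  rw [h1]
  simp

theorem hasEigenvalue_neg_of_skew {ω : V →ₗ[F] V →ₗ[F] F} (hnd : ω.SeparatingLeft)
    {x : End F V} (hx : ∀ a b, ω (x a) b = -ω a (x b)) {μ : F} (h : x.HasEigenvalue μ) :
    x.HasEigenvalue (-μ) := by
  obtain ⟨v, hv⟩ := h.exists_hasEigenvector
  by_contra hneg
  rw [End.hasEigenvalue_iff, not_not, End.eigenspace_def, LinearMap.ker_eq_bot,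
    LinearMap.injective_iff_surjective] at hneg
  refine hv.2 (hnd v fun y ↦ ?_)
  obtain ⟨z, rfl⟩ := hneg y
  have h1 := hx v z
  rw [hv.apply_eq_smul] at h1
  simp only [map_smul, LinearMap.smul_apply, smul_eq_mul] at h1
  simp [h1]

end Eigenvalues

section Triple

variable {F V : Type*} [Field F] [CharZero F] [IsAlgClosed F] [AddCommGroup V] [Module F V]
  [FiniteDimensional F V] {ω : V →ₗ[F] V →ₗ[F] F} {e x f s : End F V}

theorem exists_primitiveVector_pos (hnd : ω.SeparatingLeft)
    (hx : ∀ a b, ω (x a) b = -ω a (x b)) (he0 : e ≠ 0) (hxe : ⁅x, e⁆ = e)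
    (t : IsSl2Triple ((2 : F) • x) e f) :
    ∃ (d : ℕ) (w : V), d ≠ 0 ∧ t.HasPrimitiveVectorWith w (d : F) := by
  have hxnil : ¬ IsNilpotent x := by
    intro h
    have h1 : (LieAlgebra.ad F (End F V) x).HasEigenvalue 1 :=
      End.hasEigenvalue_of_hasEigenvector (x := e)
        ⟨by rw [End.mem_eigenspace_iff, LieAlgebra.ad_apply, hxe, one_smul], he0⟩
    have h2 := h1.isNilpotent_of_isNilpotent (LieAlgebra.ad_nilpotent_of_nilpotent h)
    exact one_ne_zero h2.eq_zero
  obtain ⟨μ, hμ, hxμ⟩ : ∃ μ : F, (∀ k : ℕ, μ + k ≠ 0) ∧ x.HasEigenvalue μ := by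
    obtain ⟨μ, hμ0, hxμ⟩ := exists_hasEigenvalue_ne_zero hxnil
    by_cases h : ∀ k : ℕ, μ + k ≠ 0
    · exact ⟨μ, h, hxμ⟩
    · push Not at h
      obtain ⟨k, hk⟩ := h
      refine ⟨-μ, fun j hj ↦ hμ0 ?_, hasEigenvalue_neg_of_skew hnd hx hxμ⟩
      have h1 : ((j + k : ℕ) : F) = 0 := by push_cast; linear_combination hj + hk
      have h2 : k = 0 := by have := Nat.cast_eq_zero.1 h1; omega
      simpa [h2] using hk
  obtain ⟨v, hv⟩ := hxμ.exists_hasEigenvector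
  obtain ⟨N, hN⟩ : IsNilpotent e :=
    isNilpotent_of_lie_eq_smul (F := F) one_ne_zero (by rw [hxe, one_smul])
  obtain ⟨k, hk, hk'⟩ := Nat.exists_not_and_succ_of_not_zero_of_exists
    (p := fun k ↦ (e ^ k) v = 0) hv.2 ⟨N, by simp [hN]⟩
  have hh : ⁅(2 : F) • x, v⁆ = (2 * μ) • v := by
    rw [End.lie_apply, LinearMap.smul_apply, hv.apply_eq_smul, smul_smul]
  have hprim : t.HasPrimitiveVectorWith ((e ^ k) v) (2 * μ + 2 * k) :=
    { ne_zero := hk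
      lie_h := t.lie_h_pow_toEnd_e hh k
      lie_e := by rw [End.lie_apply, ← End.mul_apply, ← pow_succ']; exact hk' }
  obtain ⟨d, hd⟩ := hprim.exists_nat
  refine ⟨d, _, ?_, hd ▸ hprim⟩
  rintro rfl
  apply hμ k
  have h2 : (2 : F) ≠ 0 := two_ne_zero
  apply mul_left_cancel₀ h2
  rw [mul_add, hd]; simp

/-- For an `sl₂`-triple in `𝔰𝔭(V)` whose positive root space of degree one is a line, `1/2` is an
eigenvalue of the grading element on `V`. -/
theorem exists_weight_half (hω : ω.IsAlt) (hnd : ω.SeparatingLeft)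
    (hx : ∀ a b, ω (x a) b = -ω a (x b)) (he0 : e ≠ 0) (hxe : ⁅x, e⁆ = e)
    (t : IsSl2Triple ((2 : F) • x) e f)
    (hg1 : ∀ A : End F V, (∀ a b, ω (A a) b = -ω a (A b)) → ⁅x, A⁆ = A → ∃ c : F, A = c • e) :
    ∃ v : V, v ≠ 0 ∧ x v = (1 / 2 : F) • v := by
  obtain ⟨d, w, hd, P⟩ := exists_primitiveVector_pos hnd hx he0 hxe t
  have h2 : (2 : F) ≠ 0 := two_ne_zero
  have hwt : ∀ i : ℕ, x ((f ^ i) w) = (d / 2 - i : F) • (f ^ i) w := by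
    intro i
    have h := P.lie_h_pow_toEnd_f i
    rw [End.lie_apply, LinearMap.smul_apply] at h
    apply smul_right_injective V h2
    refine h.trans ?_
    simp only [smul_smul]
    congr 1
    field_simp
  have hne : ∀ i ≤ d, (f ^ i) w ≠ 0 := fun i hi ↦ P.pow_toEnd_f_ne_zero_of_eq_nat rfl hi
  obtain ⟨m, rfl | rfl⟩ := d.even_or_odd'
  · obtain ⟨m, rfl⟩ : ∃ k, m = k + 1 := ⟨m - 1, by omega⟩
    exfalso
    have hu : x ((f ^ m) w) = (1 : F) • (f ^ m) w := by
      rw [hwt]; congr 1; push_cast; field_simp; ring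
    have hz : x ((f ^ (m + 1)) w) = (0 : F) • (f ^ (m + 1)) w := by
      rw [hwt]; congr 1; push_cast; field_simp; ring
    have hu0 := hne m (by omega)
    have hz0 := hne (m + 1) (by omega)
    have hez : e ((f ^ (m + 1)) w) ≠ 0 := by
      have h := P.lie_e_pow_succ_toEnd_f m
      rw [End.lie_apply] at h
      refine ne_of_eq_of_ne h (smul_ne_zero (mul_ne_zero (Nat.cast_add_one_ne_zero m) ?_) hu0)
      have : ((2 * (m + 1) : ℕ) : F) - m = ((m + 2 : ℕ) : F) := by push_cast; ring
      rw [this, Nat.cast_ne_zero]; omega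
    generalize (f ^ m) w = u at *
    generalize (f ^ (m + 1)) w = z at *
    obtain ⟨c, hc⟩ := hg1 (symmRankTwo ω u z) (symmRankTwo_skew hω u z)
      (by rw [lie_symmRankTwo hx hu hz]; simp)
    have huz : ω u z = 0 := form_eq_zero_of_weights hx hu hz (by simp)
    have hc0 : c = 0 := by
      have h := LinearMap.congr_fun hc.symm z
      rw [symmRankTwo_apply, hω z, huz, zero_smul, zero_smul, add_zero] at h
      exact (smul_eq_zero.1 h).resolve_right hez
    refine hz0 (hnd z fun y ↦ ?_)
    have h := congrArg x (LinearMap.congr_fun hc y)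
    simpa [hc0, hu, hz, hu0] using h
  · refine ⟨(f ^ m) w, hne m (by omega), ?_⟩
    rw [hwt]; congr 1; push_cast; field_simp; ring

theorem isNilpotent_add_of_minimal_triple (hω : ω.IsAlt) (hnd : ω.SeparatingLeft)
    (hx : ∀ a b, ω (x a) b = -ω a (x b)) (hs : ∀ a b, ω (s a) b = -ω a (s b))
    (hef : ⁅e, f⁆ = (2 : F) • x) (he0 : e ≠ 0) (hxe : ⁅x, e⁆ = e) (hxf : ⁅x, f⁆ = -f)
    (hg1 : ∀ A : End F V, (∀ a b, ω (A a) b = -ω a (A b)) → ⁅x, A⁆ = A → ∃ c : F, A = c • e)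
    (hgm1 : ∀ A : End F V, (∀ a b, ω (A a) b = -ω a (A b)) → ⁅x, A⁆ = -A → ∃ c : F, A = c • f)
    (hxs : ⁅x, s⁆ = (1 / 2 : F) • s) : IsNilpotent (f + s) := by
  have h2 : (2 : F) ≠ 0 := two_ne_zero
  have hx0 : x ≠ 0 := by rintro rfl; exact he0 (by simpa using hxe.symm)
  have t : IsSl2Triple ((2 : F) • x) e f :=
    { h_ne_zero := smul_ne_zero h2 hx0
      lie_e_f := hef
      lie_h_e_nsmul := by rw [smul_lie, hxe, ofNat_smul_eq_nsmul]
      lie_h_f_nsmul := by rw [smul_lie, hxf, smul_neg, ofNat_smul_eq_nsmul] }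
  obtain ⟨v, hv0, hv⟩ := exists_weight_half hω hnd hx he0 hxe t hg1
  obtain ⟨c, hc⟩ := hg1 (symmRankTwo ω v v) (symmRankTwo_skew hω v v)
    (by rw [lie_symmRankTwo hx hv hv]; norm_num)
  have hc0 : c ≠ 0 := by
    rintro rfl
    exact symmRankTwo_self_ne_zero hnd hv0 (by simpa using hc)
  have hev : e v = 0 := by
    have h := LinearMap.congr_fun hc.symm v
    rw [symmRankTwo_apply, hω v, zero_smul, add_zero] at h
    exact (smul_eq_zero.1 h).resolve_left hc0
  have hfv0 : f v ≠ 0 := by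
    intro h
    have h1 := LinearMap.congr_fun hef v
    simp [LieRing.of_associative_ring_bracket, h, hev, hv, hv0, eq_comm] at h1
  have hfv : x (f v) = (-(1 / 2) : F) • f v := by
    have h1 := LinearMap.congr_fun hxf v
    simp only [LieRing.of_associative_ring_bracket, LinearMap.sub_apply, End.mul_apply, hv,
      map_smul, LinearMap.neg_apply, sub_eq_iff_eq_add] at h1
    rw [h1]; module
  generalize f v = u at *
  obtain ⟨b, hb⟩ := hgm1 (symmRankTwo ω u u) (symmRankTwo_skew hω u u)
    (by rw [lie_symmRankTwo hx hfv hfv, ← neg_one_smul F]; norm_num)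
  have hb0 : b ≠ 0 := by
    rintro rfl
    exact symmRankTwo_self_ne_zero hnd hfv0 (by simpa using hb)
  have hf : ∀ y, f y = (b⁻¹ * 2 * ω u y) • u := by
    intro y
    have h := LinearMap.congr_fun hb y
    rw [symmRankTwo_apply, LinearMap.smul_apply] at h
    rw [mul_assoc, mul_smul, mul_smul, two_smul, h, smul_smul, inv_mul_cancel₀ hb0, one_smul]
  have hus : ∀ k : ℕ, ω u ((s ^ k) u) = 0 := by
    intro k
    by_cases hk : k = 2
    · subst hk
      have h1 := hs u (s u)
      rw [hω] at h1
      simpa [pow_two, eq_comm] using h1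
    · have h1 := LinearMap.congr_fun (lie_pow_eq_smul hxs k) u
      simp only [LieRing.of_associative_ring_bracket, LinearMap.sub_apply, End.mul_apply, hfv,
        map_smul, LinearMap.smul_apply, sub_eq_iff_eq_add, ← add_smul] at h1
      refine form_eq_zero_of_weights hx hfv h1 fun h ↦ hk ?_
      have h3 : (k : F) = (2 : ℕ) := by push_cast; linear_combination 2 * h
      exact_mod_cast h3
  refine isNilpotent_add_of_mul_pow_mul_eq_zero (fun k ↦ ?_)
    (isNilpotent_of_lie_eq_smul (one_div_ne_zero h2) hxs)
  ext y
  simp [hf, hus]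

end Triple

end

namespace LieAlgebra.Symplectic

theorem mem_sp_iff_skew {l R : Type*} [Fintype l] [DecidableEq l] [CommRing R]
    (A : Matrix (l ⊕ l) (l ⊕ l) R) :
    A ∈ sp l R ↔ ∀ a b, Matrix.toLinearMap₂' R (Matrix.J l R) (Matrix.toLin' A a) b =
      -Matrix.toLinearMap₂' R (Matrix.J l R) a (Matrix.toLin' A b) := by
  have h : A ∈ sp l R ↔ (Matrix.J l R).IsAdjointPair (Matrix.J l R) A (-A) := by
    rw [sp, mem_skewAdjointMatricesLieSubalgebra, mem_skewAdjointMatricesSubmodule]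
    rfl
  rw [h, ← isAdjointPair_toLinearMap₂']
  simp [LinearMap.IsAdjointPair]

theorem isAlt_toLinearMap₂'_J (l R : Type*) [Fintype l] [DecidableEq l] [CommRing R] :
    (Matrix.toLinearMap₂' R (Matrix.J l R) : (l ⊕ l → R) →ₗ[R] (l ⊕ l → R) →ₗ[R] R).IsAlt := by
  intro a
  rw [Matrix.toLinearMap₂'_apply']
  simp [Matrix.J, Matrix.fromBlocks_mulVec, Matrix.neg_mulVec, dotProduct, mul_comm]

theorem separatingLeft_toLinearMap₂'_J (l F : Type*) [Fintype l] [DecidableEq l] [Field F] :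
    (Matrix.toLinearMap₂' F (Matrix.J l F) :
      (l ⊕ l → F) →ₗ[F] (l ⊕ l → F) →ₗ[F] F).SeparatingLeft :=
  Matrix.SeparatingLeft.toLinearMap₂'
    (Matrix.separatingLeft_iff_det_ne_zero.2 (Matrix.isUnit_det_J l F).ne_zero)

theorem toLin'_lie {l R : Type*} [Fintype l] [DecidableEq l] [CommRing R] (A B : sp l R) :
    Matrix.toLin' (⁅A, B⁆ : sp l R).1 = ⁅Matrix.toLin' A.1, Matrix.toLin' B.1⁆ := by
  change Matrix.toLin' (A.1 * B.1 - B.1 * A.1) = _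
  rw [map_sub, Matrix.toLin'_mul, Matrix.toLin'_mul]
  rfl

theorem exists_toLin'_eq_smul {l R : Type*} [Fintype l] [DecidableEq l] [CommRing R]
    {x y : sp l R} {r : R} (hg : ∀ w : sp l R, ⁅x, w⁆ = r • w → ∃ c : R, w = c • y)
    (A : Module.End R (l ⊕ l → R))
    (hA : ∀ a b, Matrix.toLinearMap₂' R (Matrix.J l R) (A a) b =
      -Matrix.toLinearMap₂' R (Matrix.J l R) a (A b))
    (hxA : ⁅Matrix.toLin' x.1, A⁆ = r • A) : ∃ c : R, A = c • Matrix.toLin' y.1 := by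
  obtain ⟨A, rfl⟩ := Matrix.toLin'.surjective A
  obtain ⟨c, hc⟩ := hg ⟨A, (mem_sp_iff_skew A).2 hA⟩
    (Subtype.ext (Matrix.toLin'.injective (by rw [toLin'_lie, hxA]; simp)))
  exact ⟨c, by rw [← map_smul]; exact congrArg (fun w ↦ Matrix.toLin' w.1) hc⟩

end LieAlgebra.Symplectic


/-- In the symplectic Lie algebra sp_{2n} (type Cₙ, n ≥ 2), with a minimal
nilpotent sl₂-triple {f,2x,e}, there is no element s ∈ g_{1/2} such that f + s
is a semisimple element (i.e. such that ad(f+s) is a semisimple endomorphism). -/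
theorem stmt18 {F : Type*} [Field F] [CharZero F] [IsAlgClosed F]
    (n : ℕ) (hn : 2 ≤ n)
    (e x f : ↥(LieAlgebra.Symplectic.sp (Fin n) F))
    (hef : ⁅e, f⁆ = (2 : F) • x) (hxe : ⁅x, e⁆ = e) (hxf : ⁅x, f⁆ = -f)
    (he0 : e ≠ 0)
    (hg1 : ∀ w : ↥(LieAlgebra.Symplectic.sp (Fin n) F), ⁅x, w⁆ = w → ∃ c : F, w = c • e)
    (hgm1 : ∀ w : ↥(LieAlgebra.Symplectic.sp (Fin n) F), ⁅x, w⁆ = -w → ∃ c : F, w = c • f) :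
    ∀ s : ↥(LieAlgebra.Symplectic.sp (Fin n) F), ⁅x, s⁆ = (1 / 2 : F) • s →
      ¬ (LieAlgebra.ad F ↥(LieAlgebra.Symplectic.sp (Fin n) F) (f + s)).IsSemisimple := by
  intro s hs hss
  have key : IsNilpotent (Matrix.toLin' f.1 + Matrix.toLin' s.1) := by
    refine isNilpotent_add_of_minimal_triple (e := Matrix.toLin' e.1) (x := Matrix.toLin' x.1)
      (LieAlgebra.Symplectic.isAlt_toLinearMap₂'_J (Fin n) F)
      (LieAlgebra.Symplectic.separatingLeft_toLinearMap₂'_J (Fin n) F)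
      ((LieAlgebra.Symplectic.mem_sp_iff_skew x.1).1 x.2)
      ((LieAlgebra.Symplectic.mem_sp_iff_skew s.1).1 s.2) ?_ ?_ ?_ ?_
      (fun A hA h ↦ LieAlgebra.Symplectic.exists_toLin'_eq_smul (r := 1)
        (fun w hw ↦ hg1 w (by rw [hw, one_smul])) A hA (by rw [h, one_smul]))
      (fun A hA h ↦ LieAlgebra.Symplectic.exists_toLin'_eq_smul (r := -1)
        (fun w hw ↦ hgm1 w (by rw [hw, neg_one_smul F])) A hA (h.trans (neg_one_smul F A).symm)) ?_
    · rw [← LieAlgebra.Symplectic.toLin'_lie, hef]; simp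
    · simpa using he0
    · rw [← LieAlgebra.Symplectic.toLin'_lie, hxe]
    · rw [← LieAlgebra.Symplectic.toLin'_lie, hxf]; simp
    · rw [← LieAlgebra.Symplectic.toLin'_lie, hs]; simp
  have hnil : IsNilpotent (f + s).1 := by
    rw [← map_add] at key
    exact (IsNilpotent.map_iff (f := Matrix.toLinAlgEquiv') Matrix.toLinAlgEquiv'.injective).1 key
  have had := Module.End.eq_zero_of_isNilpotent_isSemisimple
    (LieAlgebra.isNilpotent_ad_of_isNilpotent hnil) hss
  have h1 : ⁅x, f + s⁆ = 0 := by
    rw [← lie_skew, ← LieAlgebra.ad_apply F, had, LinearMap.zero_apply, neg_zero]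
  rw [lie_add, hxf, hs, neg_add_eq_zero] at h1
  have hf0 : f = 0 := by
    have h2 : ⁅x, f⁆ = (1 / 2 : F) • f := by rw [h1, lie_smul, hs]
    rw [hxf, ← sub_eq_zero, ← neg_one_smul F f, ← sub_smul] at h2
    exact (smul_eq_zero.1 h2).resolve_left (by norm_num)
  have hx0 : x = 0 := by
    rw [hf0, lie_zero, eq_comm] at hef
    exact (smul_eq_zero.1 hef).resolve_left two_ne_zero
  exact he0 (by rw [← hxe, hx0, zero_lie])
end
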